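/- Let P be the first-return map of the Collatz map on N1 ∪ N2, H a complex Hilbert space with orthonormal basis {e_n}_{n ∈ N1∪N2}, T1, T2 the bounded operators with T1 e_n = e_{P(n)} for n ∈ N1, T1 e_n = 0 for n ∈ N2, T2 e_n = e_{P(n)} for n ∈ N2, T2 e_n = 0 for n ∈ N1, and S1 = T1*T2*, S2 = T2*. If Q is an orthogonal projection in the commutant C*(S1,S2)' and the Collatz conjecture holds, then Q e_1 = 0 or Q e_1 = e_1. -/

import Mathlib

/-- The Collatz map on positive integers: `3n+1` for odd `n`, `n/2` for even `n`. -/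
def collatz (n : ℕ+) : ℕ+ :=
  if h : (n : ℕ) % 2 = 1 then 3 * n + 1
  else ⟨(n : ℕ) / 2, by
    have h2 : 0 < n.1 := n.2
    have h3 : ¬ n.1 % 2 = 1 := h
    show 0 < n.1 / 2
    omega⟩

/-- The forward orbit of `x` under `f`. -/
def orbit {X : Type*} (f : X → X) (x : X) : Set X := Set.range fun k => f^[k] x

/-- The orbit equivalence relation induced by `f`: `x ~ y` iff the orbits meet. -/
def orbEquiv {X : Type*} (f : X → X) (x y : X) : Prop :=
  (orbit f x ∩ orbit f y).Nonempty

/-- `N₁ = {n : n ≡ 1, 5 (mod 6)}`. -/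
def N1 : Set ℕ+ := {n : ℕ+ | (n : ℕ) % 6 = 1 ∨ (n : ℕ) % 6 = 5}

/-- `N₂ = {n : n ≡ 4, 16 (mod 18)}`. -/
def N2 : Set ℕ+ := {n : ℕ+ | (n : ℕ) % 18 = 4 ∨ (n : ℕ) % 18 = 16}

/-- `y` is the first return of `x` to `S` under iteration of `f`: for some `k ≥ 1`,
`y = f^[k] x ∈ S` and no earlier positive iterate of `x` lies in `S`. -/
def IsFirstReturn {X : Type*} (f : X → X) (S : Set X) (x y : X) : Prop :=
  ∃ k : ℕ, 0 < k ∧ f^[k] x ∈ S ∧ y = f^[k] x ∧ ∀ j : ℕ, 0 < j → j < k → f^[j] x ∉ S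

/-- The C*-algebra of operators generated by a set `S` of bounded operators on a complex
Hilbert space: the closure of the (non-unital) star subalgebra generated by `S`. -/
noncomputable def CstarGen {H : Type*} [NormedAddCommGroup H] [InnerProductSpace ℂ H]
    [CompleteSpace H] (S : Set (H →L[ℂ] H)) : Set (H →L[ℂ] H) :=
  closure (NonUnitalStarAlgebra.adjoin ℂ S : Set (H →L[ℂ] H))

lemma one_mem_N1_union_N2 : (1 : ℕ+) ∈ N1 ∪ N2 := Or.inl (Or.inl rfl)

lemma collatz_odd {n : ℕ+} (h : (n : ℕ) % 2 = 1) : ((collatz n : ℕ+) : ℕ) = 3 * n + 1 := by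
  have e : collatz n = 3 * n + 1 := dif_pos h
  rw [e]
  rfl

lemma collatz_even {n : ℕ+} (h : (n : ℕ) % 2 = 0) : (n : ℕ) = 2 * (collatz n : ℕ+) := by
  have hn : ¬ (n : ℕ) % 2 = 1 := by omega
  have e : collatz n = ⟨(n : ℕ) / 2, by have h2 : 0 < (n : ℕ) := n.2; omega⟩ := dif_neg hn
  rw [e]
  show (n : ℕ) = 2 * ((n : ℕ) / 2)
  omega

lemma mem_N1_iff (n : ℕ+) : n ∈ N1 ↔ ((n : ℕ) % 6 = 1 ∨ (n : ℕ) % 6 = 5) := Iff.rfl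

lemma mem_N2_iff (n : ℕ+) : n ∈ N2 ↔ ((n : ℕ) % 18 = 4 ∨ (n : ℕ) % 18 = 16) := Iff.rfl

lemma not_both {n : ℕ+} (h1 : n ∈ N1) (h2 : n ∈ N2) : False := by
  rw [mem_N1_iff] at h1
  rw [mem_N2_iff] at h2
  omega

lemma collatz_N1 {n : ℕ+} (h : n ∈ N1) : collatz n ∈ N2 := by
  rw [mem_N1_iff] at h
  rw [mem_N2_iff, collatz_odd (by omega)]
  omega

/-- On `N1` the first return is one step. -/
lemma return_N1 {x y : ℕ+} (hx : x ∈ N1) (h : IsFirstReturn collatz (N1 ∪ N2) x y) :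
    y = collatz x := by
  obtain ⟨k, hk, _, rfl, hmin⟩ := h
  rcases Nat.lt_or_ge 1 k with h1 | h1
  · exact absurd (Or.inr (collatz_N1 hx)) (hmin 1 one_pos h1)
  · obtain rfl : k = 1 := by omega
    rfl

lemma return_N1_inj {x x' y : ℕ+} (hx : x ∈ N1) (hx' : x' ∈ N1)
    (h : IsFirstReturn collatz (N1 ∪ N2) x y) (h' : IsFirstReturn collatz (N1 ∪ N2) x' y) :
    x = x' := by
  have e : collatz x = collatz x' := (return_N1 hx h).symm.trans (return_N1 hx' h')
  have e' := congrArg (fun z : ℕ+ => (z : ℕ)) e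
  rw [mem_N1_iff] at hx hx'
  rw [collatz_odd (by omega), collatz_odd (by omega)] at e'
  apply PNat.eq
  omega

/-- Before the first return, a point of `N2` is only halved. -/
lemma halving {x : ℕ+} (hx : x ∈ N2) (k : ℕ)
    (hmin : ∀ j : ℕ, 0 < j → j < k → collatz^[j] x ∉ N1 ∪ N2) :
    ∀ j ≤ k, (x : ℕ) = 2 ^ j * (collatz^[j] x : ℕ+) := by
  intro j
  rw [mem_N2_iff] at hx
  induction j with
  | zero => intro _; simp
  | succ j ih =>
    intro hj
    have e := ih (by omega)
    have hev : ((collatz^[j] x : ℕ+) : ℕ) % 2 = 0 := by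
      rcases Nat.eq_zero_or_pos j with rfl | hpos
      · simp only [Function.iterate_zero, id]
        omega
      · have h := hmin j hpos (by omega)
        have h1 : collatz^[j] x ∉ N1 := fun hh => h (Or.inl hh)
        rw [mem_N1_iff] at h1
        have h3 : ((collatz^[j] x : ℕ+) : ℕ) % 3 ≠ 0 := by
          intro h0
          have hd : 3 ∣ (x : ℕ) := by
            rw [e]
            exact Dvd.dvd.mul_left (Nat.dvd_of_mod_eq_zero h0) _
          omega
        omega
    rw [Function.iterate_succ_apply', pow_succ, mul_assoc, ← collatz_even hev]
    exact e

lemma return_N2_aux {x x' : ℕ+} (hx : x ∈ N2) (hx' : x' ∈ N2) {k l : ℕ} (hk : 0 < k)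
    (hkl : k ≤ l)
    (hmin : ∀ j : ℕ, 0 < j → j < k → collatz^[j] x ∉ N1 ∪ N2)
    (hmin' : ∀ j : ℕ, 0 < j → j < l → collatz^[j] x' ∉ N1 ∪ N2)
    (e : collatz^[k] x = collatz^[l] x') : x = x' := by
  have a := halving hx k hmin k le_rfl
  have a' := halving hx' l hmin' l le_rfl
  have c := halving hx' l hmin' (l - k) (by omega)
  rw [← e] at a'
  have hp : 2 ^ l = 2 ^ (l - k) * 2 ^ k := by rw [← pow_add]; congr 1; omega
  rw [hp, mul_assoc, ← a] at a'
  have hx2 : collatz^[l - k] x' = x := by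
    apply PNat.eq
    exact Nat.eq_of_mul_eq_mul_left (by positivity) (c.symm.trans a')
  rcases Nat.eq_or_lt_of_le hkl with rfl | hlt
  · simpa using hx2.symm
  · exact absurd (by rw [hx2]; exact Or.inr hx) (hmin' (l - k) (by omega) (by omega))

lemma return_N2_inj {x x' y : ℕ+} (hx : x ∈ N2) (hx' : x' ∈ N2)
    (h : IsFirstReturn collatz (N1 ∪ N2) x y) (h' : IsFirstReturn collatz (N1 ∪ N2) x' y) :
    x = x' := by
  obtain ⟨k, hk, _, e, hmin⟩ := h
  obtain ⟨l, hl, _, e', hmin'⟩ := h'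
  rcases le_total k l with hkl | hkl
  · exact return_N2_aux hx hx' hk hkl hmin hmin' (e.symm.trans e')
  · exact (return_N2_aux hx' hx hl hkl hmin' hmin (e'.symm.trans e)).symm

/-- A point other than `1` reaching `1` in `k` steps: its first return also does, faster. -/
lemma return_reach {x y : ℕ+} (hx : x ≠ 1) {k : ℕ} (hk : collatz^[k] x = 1)
    (h : IsFirstReturn collatz (N1 ∪ N2) x y) : ∃ l < k, collatz^[l] y = 1 := by
  obtain ⟨j, hj, _, rfl, hmin⟩ := h
  have hk0 : 0 < k := by
    rcases Nat.eq_zero_or_pos k with rfl | h0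
    · exact absurd hk hx
    · exact h0
  rcases Nat.lt_or_ge k j with h1 | h1
  · exact absurd (by rw [hk]; exact one_mem_N1_union_N2) (hmin k hk0 h1)
  · refine ⟨k - j, by omega, ?_⟩
    rw [← Function.iterate_add_apply, Nat.sub_add_cancel h1, hk]

lemma adjoint_basis {H ι : Type*} [NormedAddCommGroup H] [InnerProductSpace ℂ H]
    [CompleteSpace H] (b : HilbertBasis ι ℂ H) (P : ι → ι) (A : Set ι) (T : H →L[ℂ] H)
    (hT : ∀ x ∈ A, T (b x) = b (P x)) (hT0 : ∀ x ∉ A, T (b x) = 0)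
    (hinj : Set.InjOn P A) {n : ι} (hn : n ∈ A) :
    ContinuousLinearMap.adjoint T (b (P n)) = b n := by
  classical
  apply b.repr.injective
  ext i
  rw [b.repr_apply_apply, b.repr_apply_apply, ContinuousLinearMap.adjoint_inner_right]
  by_cases hi : i ∈ A
  · rw [hT i hi, orthonormal_iff_ite.1 b.orthonormal, orthonormal_iff_ite.1 b.orthonormal]
    simp only [hinj.eq_iff hi hn]
  · rw [hT0 i hi, inner_zero_left, orthonormal_iff_ite.1 b.orthonormal, if_neg]
    rintro rfl
    exact hi hn

/-- If the Collatz conjecture holds, any orthogonal projection in the commutant of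
`C*(S₁,S₂)` maps `e₁` to `0` or `e₁`. -/
theorem projection_commutant_cuntz {H : Type*} [NormedAddCommGroup H] [InnerProductSpace ℂ H]
    [CompleteSpace H] (b : HilbertBasis ↥(N1 ∪ N2) ℂ H)
    (P : ↥(N1 ∪ N2) → ↥(N1 ∪ N2))
    (hP : ∀ x : ↥(N1 ∪ N2), IsFirstReturn collatz (N1 ∪ N2) ↑x ↑(P x))
    (T1 T2 : H →L[ℂ] H)
    (hT1 : ∀ x : ↥(N1 ∪ N2), ((x : ℕ+) ∈ N1 → T1 (b x) = b (P x)) ∧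
      ((x : ℕ+) ∈ N2 → T1 (b x) = 0))
    (hT2 : ∀ x : ↥(N1 ∪ N2), ((x : ℕ+) ∈ N2 → T2 (b x) = b (P x)) ∧
      ((x : ℕ+) ∈ N1 → T2 (b x) = 0))
    (S1 S2 : H →L[ℂ] H)
    (hS1 : S1 = ContinuousLinearMap.adjoint T1 * ContinuousLinearMap.adjoint T2)
    (hS2 : S2 = ContinuousLinearMap.adjoint T2)
    (Q : H →L[ℂ] H) (hQidem : Q * Q = Q) (hQsa : ContinuousLinearMap.adjoint Q = Q)
    (hQcomm : ∀ A ∈ CstarGen {S1, S2}, Q * A = A * Q)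
    (hcollatz : ∀ m : ℕ+, (1 : ℕ+) ∈ orbit collatz m) :
    Q (b ⟨1, one_mem_N1_union_N2⟩) = 0 ∨ Q (b ⟨1, one_mem_N1_union_N2⟩) = b ⟨1, one_mem_N1_union_N2⟩ := by
  classical
  set o : ↥(N1 ∪ N2) := ⟨1, one_mem_N1_union_N2⟩ with ho
  have ho1 : (o : ℕ+) ∈ N1 := Or.inl rfl
  -- commutation of `Q` with the adjoints
  have key : ∀ S ∈ ({S1, S2} : Set (H →L[ℂ] H)),
      Q * ContinuousLinearMap.adjoint S = ContinuousLinearMap.adjoint S * Q := by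
    intro S hS
    apply hQcomm
    apply subset_closure
    have h1 : S ∈ NonUnitalStarAlgebra.adjoin ℂ ({S1, S2} : Set (H →L[ℂ] H)) :=
      NonUnitalStarAlgebra.subset_adjoin ℂ _ hS
    exact star_mem h1
  have c1 := key S1 (by simp)
  have c2 := key S2 (by simp)
  -- adjoints on the basis
  have inj1 : Set.InjOn P {x | (x : ℕ+) ∈ N1} := by
    intro x hx y hy e
    apply Subtype.ext
    have h' := hP y
    rw [← e] at h'
    exact return_N1_inj hx hy (hP x) h'
  have inj2 : Set.InjOn P {x | (x : ℕ+) ∈ N2} := by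
    intro x hx y hy e
    apply Subtype.ext
    have h' := hP y
    rw [← e] at h'
    exact return_N2_inj hx hy (hP x) h'
  have a1 : ∀ n : ↥(N1 ∪ N2), (n : ℕ+) ∈ N1 →
      ContinuousLinearMap.adjoint T1 (b (P n)) = b n := fun n hn =>
    adjoint_basis b P {x | (x : ℕ+) ∈ N1} T1 (fun x hx => (hT1 x).1 hx)
      (fun x hx => (hT1 x).2 (x.2.resolve_left hx)) inj1 hn
  have a2 : ∀ n : ↥(N1 ∪ N2), (n : ℕ+) ∈ N2 →
      ContinuousLinearMap.adjoint T2 (b (P n)) = b n := fun n hn =>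
    adjoint_basis b P {x | (x : ℕ+) ∈ N2} T2 (fun x hx => (hT2 x).1 hx)
      (fun x hx => (hT2 x).2 (x.2.resolve_right hx)) inj2 hn
  have hPN1 : ∀ n : ↥(N1 ∪ N2), (n : ℕ+) ∈ N1 → ((P n : ↥(N1 ∪ N2)) : ℕ+) ∈ N2 := by
    intro n hn
    rw [return_N1 hn (hP n)]
    exact collatz_N1 hn
  -- `P (P 1) = 1`
  have hPPo : P (P o) = o := by
    have hPo : ((P o : ↥(N1 ∪ N2)) : ℕ+) = 4 := by
      rw [return_N1 ho1 (hP o)]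
      rfl
    obtain ⟨k, hk, hmem, e, hmin⟩ := hP (P o)
    rw [hPo] at hmem e hmin
    have f1 : collatz^[1] 4 = 2 := rfl
    have f2 : collatz^[2] 4 = 1 := rfl
    apply Subtype.ext
    rw [e]
    rcases Nat.lt_or_ge 2 k with h | h
    · exact absurd (by rw [f2]; exact one_mem_N1_union_N2) (hmin 2 two_pos h)
    · obtain rfl | rfl : k = 1 ∨ k = 2 := by omega
      · rw [f1] at hmem
        rcases hmem with h' | h'
        · rw [mem_N1_iff] at h'
          have : ((2 : ℕ+) : ℕ) = 2 := rfl
          omega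
        · rw [mem_N2_iff] at h'
          have : ((2 : ℕ+) : ℕ) = 2 := rfl
          omega
      · exact f2
  -- `S2* e₁ = 0`, `S1* e₁ = e₁`
  have s2o : ContinuousLinearMap.adjoint S2 (b o) = 0 := by
    rw [hS2, ContinuousLinearMap.adjoint_adjoint]
    exact (hT2 o).2 ho1
  have s1o : ContinuousLinearMap.adjoint S1 (b o) = b o := by
    have : ContinuousLinearMap.adjoint S1 = T2 * T1 := by
      rw [hS1]
      simp only [← ContinuousLinearMap.star_eq_adjoint, star_mul, star_star]
    rw [this, mul_apply_eq_comp, (hT1 o).1 ho1, (hT2 (P o)).1 (hPN1 o ho1), hPPo]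
  have v2 : ∀ n : ↥(N1 ∪ N2), (n : ℕ+) ∈ N2 → inner ℂ (b n) (Q (b o)) = 0 := by
    intro n hn
    have e := a2 n hn
    rw [← hS2] at e
    rw [← e, ← ContinuousLinearMap.adjoint_inner_right, ← mul_apply_eq_comp, ← c2,
      mul_apply_eq_comp, s2o, map_zero, inner_zero_right]
  have v1 : ∀ n : ↥(N1 ∪ N2), (n : ℕ+) ∈ N1 →
      inner ℂ (b n) (Q (b o)) = inner ℂ (b (P (P n))) (Q (b o)) := by
    intro n hn
    have e : S1 (b (P (P n))) = b n := by
      rw [hS1, mul_apply_eq_comp, a2 _ (hPN1 n hn), a1 n hn]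
    rw [← e, ← ContinuousLinearMap.adjoint_inner_right, ← mul_apply_eq_comp, ← c1,
      mul_apply_eq_comp, s1o]
  have main : ∀ k : ℕ, ∀ n : ↥(N1 ∪ N2), n ≠ o → collatz^[k] (n : ℕ+) = 1 →
      inner ℂ (b n) (Q (b o)) = 0 := by
    intro k
    induction k using Nat.strong_induction_on with
    | _ k ih =>
      intro n hno hk
      by_cases hn : (n : ℕ+) ∈ N2
      · exact v2 n hn
      · have hn1 := n.2.resolve_right hn
        rw [v1 n hn1]
        have hne : (n : ℕ+) ≠ 1 := fun h => hno (Subtype.ext h)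
        obtain ⟨l, hl, hl1⟩ := return_reach hne hk (hP n)
        have hPn : ((P n : ↥(N1 ∪ N2)) : ℕ+) ≠ 1 := by
          intro h
          have h2 := hPN1 n hn1
          rw [h] at h2
          exact not_both ho1 h2
        obtain ⟨m, hm, hm1⟩ := return_reach hPn hl1 (hP (P n))
        refine ih m (by omega) _ ?_ hm1
        intro h
        rw [← hPPo] at h
        exact hno (inj1 hn1 ho1 (inj2 (hPN1 n hn1) (hPN1 o ho1) h))
  have hQ : Q (b o) = (inner ℂ (b o) (Q (b o)) : ℂ) • b o := by
    apply b.repr.injective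
    ext i
    rw [b.repr_apply_apply, b.repr_apply_apply, inner_smul_right,
      orthonormal_iff_ite.1 b.orthonormal]
    split_ifs with h
    · rw [h, mul_one]
    · obtain ⟨k, hk⟩ := hcollatz i
      rw [mul_zero]
      exact main k i h hk
  generalize (inner ℂ (b o) (Q (b o)) : ℂ) = c at hQ
  have hb : b o ≠ 0 := b.orthonormal.ne_zero o
  have hQQ : Q (Q (b o)) = Q (b o) := by
    rw [← mul_apply_eq_comp, hQidem]
  rw [hQ, map_smul, hQ, smul_smul] at hQQ
  have hc : c * c = c := smul_left_injective ℂ hb hQQ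
  rcases eq_or_ne c 0 with h0 | h0
  · left
    rw [hQ, h0, zero_smul]
  · right
    rw [hQ, mul_left_cancel₀ h0 (hc.trans (mul_one c).symm), one_smul]
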